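/- Let A be a finite simple graph that is connected, is not a complete graph, contains a triangle, contains no clique of size 4, contains no induced 4-cycle, and has a vertex v1 such that {v1} is a hitting set of A (i.e., A − v1 has no induced P3). Then: (1) v1 has no true twin in A; (2) every pair of true twins of A lies in a triangle; (3) every triangle of A contains a pair of true twins; and (4) any two distinct pairs of true twins of A are vertex-disjoint and there is no edge of A between them. -/

import Mathlib

/-- An induced `P₃` in `A`: three distinct vertices `a, b, c` such that
`ab` and `bc` are edges of `A` and `ac` is not an edge. -/
def IsInducedP3 {V : Type*} (A : SimpleGraph V) (a b c : V) : Prop :=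
  a ≠ c ∧ A.Adj a b ∧ A.Adj b c ∧ ¬ A.Adj a c

/-- `u` and `u'` are true twins in `A`: they are adjacent and every vertex
`w ∉ {u, u'}` is adjacent to `u` iff it is adjacent to `u'`. -/
def TrueTwins {V : Type*} (A : SimpleGraph V) (u u' : V) : Prop :=
  A.Adj u u' ∧ ∀ w : V, w ≠ u → w ≠ u' → (A.Adj w u ↔ A.Adj w u')

/-- If every induced `P₃` of `A` contains `v`, then adjacency is transitive away from `v`. -/
theorem adj_trans_of_hits {V : Type*} {A : SimpleGraph V} {v : V}
    (hhit : ∀ a b c : V, IsInducedP3 A a b c → v = a ∨ v = b ∨ v = c)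
    {a b c : V} (ha : a ≠ v) (hb : b ≠ v) (hc : c ≠ v) (hac : a ≠ c)
    (hab : A.Adj a b) (hbc : A.Adj b c) : A.Adj a c := by
  by_contra h
  rcases hhit a b c ⟨hac, hab, hbc, h⟩ with h | h | h
  exacts [ha h.symm, hb h.symm, hc h.symm]

/-- In a connected graph all of whose induced `P₃`s contain `v`, every vertex is within
distance two of `v`. -/
theorem near_of_hits {V : Type*} {A : SimpleGraph V} {v : V} (hconn : A.Connected)
    (hhit : ∀ a b c : V, IsInducedP3 A a b c → v = a ∨ v = b ∨ v = c) (u : V) :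
    u = v ∨ A.Adj u v ∨ ∃ w, w ≠ v ∧ A.Adj u w ∧ A.Adj w v := by
  obtain ⟨p⟩ := hconn.preconnected u v
  induction p with
  | nil => exact Or.inl rfl
  | @cons a b c hab _ ih =>
    by_cases hac : a = c
    · exact Or.inl hac
    rcases ih hhit with h | h | ⟨w, hw, hbw, hwc⟩
    · exact Or.inr (Or.inl (h ▸ hab))
    · exact Or.inr (Or.inr ⟨b, h.ne, hab, h⟩)
    · by_cases hbc : b = c
      · exact Or.inr (Or.inl (hbc ▸ hab))
      by_cases haw : a = w
      · exact Or.inr (Or.inl (haw ▸ hwc))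
      · exact Or.inr (Or.inr ⟨w, hw, adj_trans_of_hits hhit hac hbc hw haw hab hbw, hwc⟩)

/-- Four pairwise adjacent vertices form a clique of size four. -/
theorem exists_clique_card_four {V : Type*} {A : SimpleGraph V} {a b c d : V}
    (hab : A.Adj a b) (hac : A.Adj a c) (had : A.Adj a d)
    (hbc : A.Adj b c) (hbd : A.Adj b d) (hcd : A.Adj c d) :
    ∃ S : Finset V, S.card = 4 ∧ A.IsClique (S : Set V) := by
  classical
  refine ⟨{a, b, c, d}, ?_, ?_⟩
  · simp [hab.ne, hac.ne, had.ne, hbc.ne, hbd.ne, hcd.ne]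
  · simp [SimpleGraph.isClique_insert, *]

/-- If every induced `P₃` contains `v`, adjacent vertices other than `v` that agree on
adjacency to `v` are true twins. -/
theorem trueTwins_of_hits {V : Type*} {A : SimpleGraph V} {v : V}
    (hhit : ∀ a b c : V, IsInducedP3 A a b c → v = a ∨ v = b ∨ v = c)
    {a b : V} (ha : a ≠ v) (hb : b ≠ v) (hab : A.Adj a b) (h : A.Adj v a ↔ A.Adj v b) :
    TrueTwins A a b := by
  refine ⟨hab, fun w hwa hwb => ?_⟩
  by_cases hw : w = v
  · exact hw ▸ h
  · exact ⟨fun k => adj_trans_of_hits hhit hw ha hb hwb k hab,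
      fun k => adj_trans_of_hits hhit hw hb ha hwa k hab.symm⟩

/-- Let `A` be connected, not complete, containing a triangle, `K₄`-free,
induced-`C₄`-free, and suppose `{v₁}` is a hitting set of `A` (every induced
`P₃` of `A` contains `v₁`).  Then:
(1) `v₁` has no true twin;
(2) every pair of true twins lies in a triangle;
(3) every triangle contains a pair of true twins;
(4) any two distinct pairs of true twins are vertex-disjoint, with no edge
between them. -/
theorem stmt_18 {V : Type*} [Fintype V] (A : SimpleGraph V)
    (hconn : A.Connected)
    (hnotcomplete : ∃ u v : V, u ≠ v ∧ ¬ A.Adj u v)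
    (htriangle : ∃ a b c : V, A.Adj a b ∧ A.Adj a c ∧ A.Adj b c)
    (hK4free : ¬ ∃ S : Finset V, S.card = 4 ∧ A.IsClique (S : Set V))
    (hC4free : ¬ ∃ a b c d : V, a ≠ c ∧ b ≠ d ∧
      A.Adj a b ∧ A.Adj b c ∧ A.Adj c d ∧ A.Adj d a ∧ ¬ A.Adj a c ∧ ¬ A.Adj b d)
    (v₁ : V) (hhit : ∀ a b c : V, IsInducedP3 A a b c → v₁ = a ∨ v₁ = b ∨ v₁ = c) :
    (∀ u : V, ¬ TrueTwins A v₁ u) ∧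
    (∀ u u' : V, TrueTwins A u u' → ∃ w : V, A.Adj u w ∧ A.Adj u' w) ∧
    (∀ a b c : V, A.Adj a b → A.Adj a c → A.Adj b c →
      TrueTwins A a b ∨ TrueTwins A a c ∨ TrueTwins A b c) ∧
    (∀ u u' x x' : V, TrueTwins A u u' → TrueTwins A x x' →
      ({u, u'} : Set V) ≠ ({x, x'} : Set V) →
      ∀ p ∈ ({u, u'} : Set V), ∀ q ∈ ({x, x'} : Set V),
        p ≠ q ∧ ¬ A.Adj p q) := by
  have trans := @adj_trans_of_hits V A v₁ hhit
  have near := near_of_hits hconn hhit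
  have noK4 : ∀ {a b c d : V}, A.Adj a b → A.Adj a c → A.Adj a d → A.Adj b c → A.Adj b d →
      A.Adj c d → False := fun hab hac had hbc hbd hcd =>
    hK4free (exists_clique_card_four hab hac had hbc hbd hcd)
  have notwin : ∀ u : V, ¬ TrueTwins A v₁ u := by
    rintro u ⟨hu, htw⟩
    have huniv : ∀ x, x ≠ v₁ → x ≠ u → A.Adj x u := by
      intro x hxv hxu
      rcases near x with h | h | ⟨w, hw, hxw, hwv⟩
      · exact absurd h hxv
      · exact (htw x hxv hxu).1 h
      · by_cases hwu : w = u
        · exact hwu ▸ hxw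
        · exact trans hxv hw hu.ne' hxu hxw ((htw w hw hwu).1 hwv)
    have huniv' : ∀ x, x ≠ v₁ → A.Adj x v₁ := by
      intro x hxv
      by_cases hxu : x = u
      · exact hxu ▸ hu.symm
      · exact (htw x hxv hxu).2 (huniv x hxv hxu)
    obtain ⟨a, b, hab, hnab⟩ := hnotcomplete
    have hav : a ≠ v₁ := fun h => hnab (h ▸ (huniv' b (fun k => hab (h.trans k.symm))).symm)
    have hbv : b ≠ v₁ := fun h => hnab (h ▸ huniv' a hav)
    have hau : a ≠ u := fun h => hnab (h ▸ (huniv b hbv (fun k => hab (h.trans k.symm))).symm)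
    have hbu : b ≠ u := fun h => hnab (h ▸ huniv a hav hau)
    exact hnab (trans hav hu.ne' hbv hab (huniv a hav hau) (huniv b hbv hbu).symm)
  have symm : ∀ {a b : V}, TrueTwins A a b → TrueTwins A b a := fun h =>
    ⟨h.1.symm, fun w hb ha => (h.2 w ha hb).symm⟩
  have ne_left : ∀ {a b : V}, TrueTwins A a b → a ≠ v₁ := fun {a b} h k =>
    notwin b (k ▸ h)
  have ne_right : ∀ {a b : V}, TrueTwins A a b → b ≠ v₁ := fun h => ne_left (symm h)
  have common : ∀ u u' : V, TrueTwins A u u' →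
      ∃ w, A.Adj u w ∧ A.Adj u' w ∧ (w = v₁ ∨ A.Adj w v₁ ∧ ¬ A.Adj u v₁) := by
    intro u u' h
    have hv := h.2 v₁ (ne_left h).symm (ne_right h).symm
    by_cases huv : A.Adj u v₁
    · exact ⟨v₁, huv, (hv.1 huv.symm).symm, Or.inl rfl⟩
    rcases near u with k | k | ⟨w, -, huw, hwv⟩
    · exact absurd k (ne_left h)
    · exact absurd k huv
    · have hwu' : w ≠ u' := by
        rintro rfl
        exact huv (hv.2 hwv.symm).symm
      exact ⟨w, huw, ((h.2 w huw.ne' hwu').1 huw.symm).symm, Or.inr ⟨hwv, huv⟩⟩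
  have nothree : ∀ {a b c : V}, b ≠ c → TrueTwins A a b → TrueTwins A a c → False := by
    intro a b c hbc hab hac
    obtain ⟨w, haw, hbw, hw⟩ := common a b hab
    have hvc := hac.2 v₁ (ne_left hac).symm (ne_right hac).symm
    have hcw : c ≠ w := by
      rintro rfl
      rcases hw with h | ⟨h, k⟩
      · exact ne_right hac h
      · exact k (hvc.2 h.symm).symm
    have hwc : A.Adj w c := (hac.2 w haw.ne' hcw.symm).1 haw.symm
    exact noK4 hab.1 hac.1 haw ((hac.2 b hab.1.ne' hbc).1 hab.1.symm) hbw hwc.symm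
  refine ⟨notwin, fun u u' h => ?_, fun a b c hab hac hbc => ?_, ?_⟩
  · obtain ⟨w, huw, hu'w, -⟩ := common u u' h
    exact ⟨w, huw, hu'w⟩
  · have tw := @trueTwins_of_hits V A v₁ hhit
    by_cases ha : a = v₁
    · subst ha
      exact Or.inr (Or.inr (tw hab.ne' hac.ne' hbc (iff_of_true hab hac)))
    by_cases hb : b = v₁
    · subst hb
      exact Or.inr (Or.inl (tw ha hbc.ne' hac (iff_of_true hab.symm hbc)))
    by_cases hc : c = v₁
    · subst hc
      exact Or.inl (tw ha hb hab (iff_of_true hac.symm hbc.symm))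
    have hab' := tw ha hb hab
    have hac' := tw ha hc hac
    have hbc' := tw hb hc hbc
    tauto
  · have main : ∀ {p p' q q' : V}, TrueTwins A p p' → TrueTwins A q q' →
        ¬ (p = q ∧ p' = q') → ¬ (p = q' ∧ p' = q) → p ≠ q ∧ ¬ A.Adj p q := by
      intro p p' q q' hp hq h1 h2
      have hpq : p ≠ q := by
        rintro rfl
        exact nothree (fun h => h1 ⟨rfl, h⟩) hp hq
      refine ⟨hpq, fun hadj => ?_⟩
      have hpq' : p ≠ q' := by
        rintro rfl
        exact nothree (fun h => h2 ⟨rfl, h⟩) hp (symm hq)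
      have hp'q : p' ≠ q := by
        rintro rfl
        exact nothree hpq' (symm hp) hq
      have hp'q' : p' ≠ q' := by
        rintro rfl
        exact nothree hpq (symm hp) (symm hq)
      have hpq'_adj := (hq.2 p hpq hpq').1 hadj
      exact noK4 hp.1 hadj hpq'_adj ((hp.2 q hpq.symm hp'q.symm).1 hadj.symm).symm
        ((hp.2 q' hpq'.symm hp'q'.symm).1 hpq'_adj.symm).symm hq.1
    intro u u' x x' hu hx hne p hp q hq
    have h1 : ¬ (u = x ∧ u' = x') := by
      rintro ⟨rfl, rfl⟩
      exact hne rfl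
    have h2 : ¬ (u = x' ∧ u' = x) := by
      rintro ⟨rfl, rfl⟩
      exact hne (Set.pair_comm _ _)
    rcases hp with rfl | rfl <;> rcases hq with rfl | rfl
    · exact main hu hx h1 h2
    · exact main hu (symm hx) h2 h1
    · exact main (symm hu) hx (fun h => h2 h.symm) (fun h => h1 h.symm)
    · exact main (symm hu) (symm hx) (fun h => h1 h.symm) (fun h => h2 h.symm)
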